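/- arXiv:2511.19247 — 2 statements merged into one kernel-verified Lean document; each statement's English description precedes it below -/
import Mathlib

section
/- Let n ≥ 1, p ≥ 1, t ∈ ℝ, let 𝒮 = (S_0,…,S_{2n}) in 𝕊_p(ℝ), and T_i := Σ_{ℓ=0}^{i} binom(i,ℓ)(−1)^ℓ t^ℓ S_{i−ℓ} for i ∈ {0,…,2n}. If a matrix polynomial P(x) = Σ_{i=0}^{n} x^i P_i with P_i ∈ M_p(ℝ) is a block column relation of M_𝒯(n) (i.e., Σ_{i=0}^{n} X_𝒯^i P_i = 0), then the matrix polynomial P(x−t) is a block column relation of M_𝒮(n) (i.e., writing P(x−t) = Σ_{i=0}^{n} x^i Q_i, one has Σ_{i=0}^{n} X_𝒮^i Q_i = 0). -/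
open Finset Matrix

/-- The `i`-th block column `X_R^i = col(R_i, …, R_{i+n})` of the moment matrix. -/
def blockCol (n p : ℕ) (R : ℕ → Matrix (Fin p) (Fin p) ℝ) (i : ℕ) :
    Matrix (Fin (n + 1) × Fin p) (Fin p) ℝ :=
  fun rb c => R (rb.1.1 + i) rb.2 c

/-- The shifted moments `T_i = ∑_{ℓ=0}^{i} C(i,ℓ)(-1)^ℓ t^ℓ S_{i-ℓ}`. -/
def shiftT (p : ℕ) (t : ℝ) (S : ℕ → Matrix (Fin p) (Fin p) ℝ) (i : ℕ) :
    Matrix (Fin p) (Fin p) ℝ :=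
  ∑ l ∈ Finset.range (i + 1), ((i.choose l : ℝ) * (-1) ^ l * t ^ l) • S (i - l)

open Polynomial in
/-- The linear functional on real polynomials with moments `s`, that is `X ^ k ↦ s k`. -/
noncomputable def momentFunctional (s : ℕ → ℝ) : ℝ[X] →ₗ[ℝ] ℝ :=
  (Polynomial.basisMonomials ℝ).constr ℝ s

open Polynomial in
theorem momentFunctional_X_pow (s : ℕ → ℝ) (k : ℕ) : momentFunctional s (X ^ k) = s k := by
  rw [X_pow_eq_monomial]
  exact (Polynomial.basisMonomials ℝ).constr_basis ℝ s k

open Polynomial in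
theorem shiftT_apply (p : ℕ) (t : ℝ) (S : ℕ → Matrix (Fin p) (Fin p) ℝ) (m : ℕ) (b a : Fin p) :
    shiftT p t S m b a = momentFunctional (fun k => S k b a) ((X - C t) ^ m) := by
  have h : (X - C t : ℝ[X]) ^ m =
      ∑ l ∈ range (m + 1), ((m.choose l : ℝ) * (-1) ^ l * t ^ l) • X ^ (m - l) := by
    rw [sub_eq_neg_add, add_pow]
    refine Finset.sum_congr rfl fun l _ => ?_
    rw [smul_eq_C_mul, neg_pow]
    simp only [map_mul, map_pow, map_neg, map_one, map_natCast]
    ring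
  simp only [h, map_sum, map_smul, momentFunctional_X_pow, shiftT, Matrix.sum_apply,
    Matrix.smul_apply]

open Polynomial in
/-- The entries of `∑ X_R^i P_i`, where `R` has moments `R m = L (u ^ m)`. -/
theorem sum_blockCol_mul_apply (n p : ℕ) (R P : ℕ → Matrix (Fin p) (Fin p) ℝ)
    (L : Fin p → Fin p → ℝ[X] →ₗ[ℝ] ℝ) (u : ℝ[X]) (hR : ∀ m b a, R m b a = L b a (u ^ m))
    (j : Fin (n + 1)) (b c : Fin p) :
    (∑ i ∈ range (n + 1), blockCol n p R i * P i) (j, b) c =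
      ∑ a, L b a (u ^ (j : ℕ) * ∑ i ∈ range (n + 1), P i a c • u ^ i) := by
  simp only [Matrix.sum_apply, Matrix.mul_apply, blockCol, hR, Finset.mul_sum, mul_smul_comm,
    map_sum, map_smul, ← pow_add, smul_eq_mul]
  rw [Finset.sum_comm]
  simp only [mul_comm]

/-- **Corollary 2.6**: a block column relation `P(x)` of `M_𝒯(n)` yields the block column
relation `P(x - t)` of `M_𝒮(n)`. Here `Q` is determined by `P(x-t) = ∑ x^i Q_i`, i.e.
`∑ x^i Q_i = ∑ (x-t)^i P_i` for all real `x`. -/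
theorem column_relation_translation (n p : ℕ) (hn : 1 ≤ n) (hp : 0 < p)
    (S : ℕ → Matrix (Fin p) (Fin p) ℝ) (t : ℝ)
    (P Q : ℕ → Matrix (Fin p) (Fin p) ℝ)
    (hQ : ∀ x : ℝ,
      (∑ i ∈ Finset.range (n + 1), x ^ i • Q i) =
        ∑ i ∈ Finset.range (n + 1), (x - t) ^ i • P i)
    (hrel : (∑ i ∈ Finset.range (n + 1), blockCol n p (shiftT p t S) i * P i) = 0) :
    (∑ i ∈ Finset.range (n + 1), blockCol n p S i * Q i) = 0 := by
  have hpoly : ∀ a c, (∑ i ∈ range (n + 1), Q i a c • (Polynomial.X : Polynomial ℝ) ^ i) =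
      ∑ i ∈ range (n + 1), P i a c • (Polynomial.X - Polynomial.C t) ^ i := by
    intro a c
    refine Polynomial.funext fun x => ?_
    have h := congrFun (congrFun (hQ x) a) c
    simpa [Matrix.sum_apply, Polynomial.eval_finsetSum, mul_comm] using h
  ext ⟨j, b⟩ c
  rw [sum_blockCol_mul_apply n p S Q (fun b a => momentFunctional fun k => S k b a) Polynomial.X
    fun m b a => (momentFunctional_X_pow (fun k => S k b a) m).symm]
  have hT : ∀ l ∈ range ((j : ℕ) + 1),
      ∑ a, momentFunctional (fun k => S k b a) ((Polynomial.X - Polynomial.C t) ^ l *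
        ∑ i ∈ range (n + 1), P i a c • (Polynomial.X - Polynomial.C t) ^ i) = 0 := by
    intro l hl
    have hln : l < n + 1 := by
      have := Finset.mem_range.mp hl
      omega
    rw [← sum_blockCol_mul_apply n p (shiftT p t S) P
      (fun b a => momentFunctional fun k => S k b a) _ (shiftT_apply p t S) ⟨l, hln⟩ b c, hrel]
    rfl
  have hX : (Polynomial.X : Polynomial ℝ) ^ (j : ℕ) = ∑ l ∈ range ((j : ℕ) + 1),
      (t ^ ((j : ℕ) - l) * ((j : ℕ).choose l : ℝ)) • (Polynomial.X - Polynomial.C t) ^ l := by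
    conv_lhs => rw [← sub_add_cancel Polynomial.X (Polynomial.C t), add_pow]
    refine Finset.sum_congr rfl fun l _ => ?_
    rw [Polynomial.smul_eq_C_mul]
    simp only [map_mul, map_pow, map_natCast]
    ring
  simp only [hpoly, hX, Finset.sum_mul, smul_mul_assoc, map_sum, map_smul]
  rw [Finset.sum_comm]
  refine Finset.sum_eq_zero fun l hl => ?_
  rw [← Finset.smul_sum, hT l hl, smul_zero]
end

section
/- Let n ≥ 1, p ≥ 1 and let μ = (ℓ; x_1,…,x_ℓ; A_1,…,A_ℓ), with ℓ ≥ 1, pairwise distinct x_j ∈ ℝ and nonzero psd A_j ∈ 𝕊_p(ℝ), be a minimal representing measure for 𝒮 = (S_0,…,S_{2n}), i.e., S_i = Σ_{j=1}^ℓ x_j^i A_j for i ∈ {0,…,2n} and Σ_{j=1}^ℓ rank A_j = rank M(n). Fix j₀ ∈ {1,…,ℓ} and define S̃_i := Σ_{j≠j₀} x_j^i A_j for i ∈ {0,…,2n+2}. Then rank M_{S̃}(n) = rank M_{S̃}(n+1) = rank M(n) − rank A_{j₀}, where M_{S̃}(n) := (S̃_{i+j−2})_{i,j=1}^{n+1}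 and M_{S̃}(n+1) := (S̃_{i+j−2})_{i,j=1}^{n+2}. -/
open Finset Matrix

/-- The block Hankel moment matrix `M(N) = (S_{i+j-2})_{i,j=1}^{N+1}`. -/
def momentMatrix (N p : ℕ) (S : ℕ → Matrix (Fin p) (Fin p) ℝ) :
    Matrix (Fin (N + 1) × Fin p) (Fin (N + 1) × Fin p) ℝ :=
  fun ia jb => S (ia.1.1 + jb.1.1) ia.2 jb.2

lemma Matrix.rank_add_le {m n K : Type*} [Fintype n] [Finite m] [Field K]
    (A B : Matrix m n K) : (A + B).rank ≤ A.rank + B.rank := by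
  have h : LinearMap.range (A + B).mulVecLin ≤
      LinearMap.range A.mulVecLin ⊔ LinearMap.range B.mulVecLin := by
    rw [Matrix.mulVecLin_add]
    exact LinearMap.range_add_le _ _
  exact (Submodule.finrank_mono h).trans (Submodule.finrank_add_le_finrank_add_finrank _ _)

/-- The moment matrix of a single atom `B` at `t` has rank at most that of `B`. -/
lemma rank_momentMatrix_atom_le (N p : ℕ) (t : ℝ) (B : Matrix (Fin p) (Fin p) ℝ) :
    (momentMatrix N p (fun i => t ^ i • B)).rank ≤ B.rank := by
  let V : Matrix (Fin (N + 1) × Fin p) (Fin p) ℝ :=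
    Matrix.of fun ia b => t ^ ia.1.1 * (1 : Matrix (Fin p) (Fin p) ℝ) ia.2 b
  have h : momentMatrix N p (fun i => t ^ i • B) = V * B * Vᵀ := by
    ext ⟨i, a⟩ ⟨j, b⟩
    simp [momentMatrix, V, Matrix.mul_apply, Matrix.one_apply, pow_add]
    ring
  rw [h]
  exact (Matrix.rank_mul_le_left _ _).trans (Matrix.rank_mul_le_right _ _)

lemma rank_momentMatrix_sum_le {ι : Type*} (N p : ℕ) (s : Finset ι) (x : ι → ℝ)
    (A : ι → Matrix (Fin p) (Fin p) ℝ) :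
    (momentMatrix N p (fun i => ∑ j ∈ s, x j ^ i • A j)).rank ≤ ∑ j ∈ s, (A j).rank := by
  classical
  induction s using Finset.induction_on with
  | empty =>
    have h : momentMatrix N p (fun i => ∑ j ∈ (∅ : Finset ι), x j ^ i • A j) = 0 := by
      ext
      simp [momentMatrix]
    rw [h, Matrix.rank_zero]
    exact Nat.zero_le _
  | insert a s ha ih =>
    have h : momentMatrix N p (fun i => ∑ j ∈ insert a s, x j ^ i • A j) =
        momentMatrix N p (fun i => x a ^ i • A a) +
          momentMatrix N p (fun i => ∑ j ∈ s, x j ^ i • A j) := by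
      ext
      simp [momentMatrix, Finset.sum_insert ha]
    rw [h, Finset.sum_insert ha]
    exact (Matrix.rank_add_le _ _).trans
      (Nat.add_le_add (rank_momentMatrix_atom_le N p (x a) (A a)) ih)

lemma rank_momentMatrix_le_succ (N p : ℕ) (S : ℕ → Matrix (Fin p) (Fin p) ℝ) :
    (momentMatrix N p S).rank ≤ (momentMatrix (N + 1) p S).rank := by
  have h : momentMatrix N p S = (momentMatrix (N + 1) p S).submatrix
      (Prod.map Fin.castSucc id) (Prod.map Fin.castSucc id) := by
    ext
    simp [momentMatrix]
  rw [h]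
  exact Matrix.rank_submatrix_le _ _ _

/-- Removing an atom `x j₀` from a minimal representing measure drops the rank of both
`M(n)` and `M(n+1)` (built from the moments `S̃_i = ∑_{j ≠ j₀} x_j^i A_j`) by exactly
`rank A_{j₀}`. -/
theorem remove_atom_rank (n p : ℕ) (hn : 1 ≤ n) (hp : 0 < p)
    (ℓ : ℕ) (hℓ : 1 ≤ ℓ) (x : Fin ℓ → ℝ) (A : Fin ℓ → Matrix (Fin p) (Fin p) ℝ)
    (S : ℕ → Matrix (Fin p) (Fin p) ℝ)
    (hx : Function.Injective x) (hpsd : ∀ j, (A j).PosSemidef) (hA0 : ∀ j, A j ≠ 0)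
    (hmom : ∀ i, i ≤ 2 * n → S i = ∑ j, x j ^ i • A j)
    (hmin : (∑ j, (A j).rank) = (momentMatrix n p S).rank)
    (j₀ : Fin ℓ) :
    (momentMatrix n p
        (fun i => ∑ j ∈ Finset.univ.erase j₀, x j ^ i • A j)).rank =
      (momentMatrix n p S).rank - (A j₀).rank ∧
    (momentMatrix (n + 1) p
        (fun i => ∑ j ∈ Finset.univ.erase j₀, x j ^ i • A j)).rank =
      (momentMatrix n p S).rank - (A j₀).rank := by
  have hsplit : momentMatrix n p S =
      momentMatrix n p (fun i => x j₀ ^ i • A j₀) +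
        momentMatrix n p (fun i => ∑ j ∈ Finset.univ.erase j₀, x j ^ i • A j) := by
    ext ⟨i, a⟩ ⟨j, b⟩
    have hij : i.1 + j.1 ≤ 2 * n := by omega
    simp only [momentMatrix, Matrix.add_apply]
    rw [hmom _ hij, ← Finset.add_sum_erase _ _ (Finset.mem_univ j₀), Matrix.add_apply]
  have hlower := Matrix.rank_add_le (momentMatrix n p (fun i => x j₀ ^ i • A j₀))
    (momentMatrix n p (fun i => ∑ j ∈ Finset.univ.erase j₀, x j ^ i • A j))
  rw [← hsplit] at hlower
  have hatom := rank_momentMatrix_atom_le n p (x j₀) (A j₀)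
  have hmono := rank_momentMatrix_le_succ n p
    (fun i => ∑ j ∈ Finset.univ.erase j₀, x j ^ i • A j)
  have hupper := rank_momentMatrix_sum_le (n + 1) p (Finset.univ.erase j₀) x A
  have hsum := Finset.add_sum_erase Finset.univ (fun j => (A j).rank) (Finset.mem_univ j₀)
  omega
end
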